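/- Let q, z, c be complex numbers with |q| < 1 and |cq| < 1, c ≠ 0 (and such that no factor (zq;q)_n or (cq;q)_n vanishes). Then ∑_{n=1}^∞ ( z^{n-1} (-cq;q)_{n-1} q^{n(n+1)/2} ) / ( (zq;q)_n (cq;q)_n ) = ∑_{n=1}^∞ ( (-zq/c;q)_{n-1} c^{n-1} q^n ) / (zq;q)_n. -/

import Mathlib

/-- The finite q-Pochhammer symbol `(A;q)_n = (1-A)(1-Aq)⋯(1-Aq^{n-1})`. -/
noncomputable def qPoch (q A : ℂ) (n : ℕ) : ℂ := ∏ k ∈ Finset.range n, (1 - A * q ^ k)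

/-- The infinite q-Pochhammer symbol `(A;q)_∞ = ∏_{k≥0} (1 - A q^k)`. -/
noncomputable def qPochInf (q A : ℂ) : ℂ := ∏' k : ℕ, (1 - A * q ^ k)

open Filter Topology Finset

lemma qPoch_succ (q A : ℂ) (n : ℕ) : qPoch q A (n + 1) = qPoch q A n * (1 - A * q ^ n) :=
  prod_range_succ _ _

lemma summable_norm_neg_mul_pow {q : ℂ} (hq : ‖q‖ < 1) (A : ℂ) :
    Summable fun k : ℕ => ‖-(A * q ^ k)‖ := by
  simpa using (summable_geometric_of_lt_one (norm_nonneg q) hq).mul_left ‖A‖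

lemma tendsto_qPoch {q : ℂ} (hq : ‖q‖ < 1) (A : ℂ) :
    Tendsto (qPoch q A) atTop (𝓝 (qPochInf q A)) := by
  have h := (multipliable_one_add_of_summable
    (summable_norm_neg_mul_pow hq A)).hasProd.tendsto_prod_nat
  simp only [← sub_eq_add_neg] at h
  exact h

lemma qPochInf_ne_zero {q : ℂ} (hq : ‖q‖ < 1) {A : ℂ} (hA : ∀ n : ℕ, 1 - A * q ^ n ≠ 0) :
    qPochInf q A ≠ 0 := by
  have h := tprod_one_add_ne_zero_of_summable (f := fun k : ℕ => -(A * q ^ k))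
    (fun k => by simpa only [← sub_eq_add_neg] using hA k) (summable_norm_neg_mul_pow hq A)
  simp only [← sub_eq_add_neg] at h
  exact h

lemma qPoch_ne_zero {q A : ℂ} (hA : ∀ n : ℕ, 1 - A * q ^ n ≠ 0) (n : ℕ) : qPoch q A n ≠ 0 :=
  prod_ne_zero_iff.mpr fun k _ => hA k

lemma exists_norm_le_of_tendsto {f : ℕ → ℂ} {a : ℂ} (h : Tendsto f atTop (𝓝 a)) :
    ∃ M, 0 ≤ M ∧ ∀ n, ‖f n‖ ≤ M := by
  obtain ⟨M, hM⟩ := h.norm.bddAbove_range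
  have hM' : ∀ n, ‖f n‖ ≤ M := fun n => hM ⟨n, rfl⟩
  exact ⟨M, (norm_nonneg _).trans (hM' 0), hM'⟩

lemma exists_norm_qPoch_le {q : ℂ} (hq : ‖q‖ < 1) (A : ℂ) :
    ∃ M, 0 ≤ M ∧ ∀ n, ‖qPoch q A n‖ ≤ M :=
  exists_norm_le_of_tendsto (tendsto_qPoch hq A)

lemma exists_norm_inv_qPoch_le {q : ℂ} (hq : ‖q‖ < 1) {A : ℂ} (hA : ∀ n : ℕ, 1 - A * q ^ n ≠ 0) :
    ∃ M, 0 ≤ M ∧ ∀ n, ‖(qPoch q A n)⁻¹‖ ≤ M :=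
  exists_norm_le_of_tendsto ((tendsto_qPoch hq A).inv₀ (qPochInf_ne_zero hq hA))

lemma triangular_succ (n : ℕ) :
    (n + 1 + 1) * (n + 1 + 2) / 2 = (n + 1) * (n + 2) / 2 + (n + 2) := by
  rw [← Nat.add_mul_div_right _ _ (by norm_num : 0 < 2)]
  congr 1
  ring

lemma summable_norm_pow_mul_pow_triangular {q : ℂ} (hq : ‖q‖ < 1) (z : ℂ) :
    Summable fun n : ℕ => ‖z ^ n * q ^ ((n + 1) * (n + 2) / 2)‖ := by
  have h0 : Tendsto (fun n : ℕ => ‖z‖ * ‖q‖ ^ (n + 2)) atTop (𝓝 0) := by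
    simpa using ((tendsto_pow_atTop_nhds_zero_of_lt_one (norm_nonneg q) hq).comp
      (tendsto_add_atTop_nat 2)).const_mul ‖z‖
  refine summable_of_ratio_norm_eventually_le (r := 1 / 2) (by norm_num) ?_
  filter_upwards [h0.eventually (ge_mem_nhds (by norm_num : (0 : ℝ) < 1 / 2))] with n hn
  rw [norm_norm, norm_norm, triangular_succ]
  calc ‖z ^ (n + 1) * q ^ ((n + 1) * (n + 2) / 2 + (n + 2))‖
      = ‖z‖ * ‖q‖ ^ (n + 2) * ‖z ^ n * q ^ ((n + 1) * (n + 2) / 2)‖ := by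
        simp only [norm_mul, norm_pow]; ring
    _ ≤ _ := by gcongr

/-- A Heine-type series whose denominators are shifted by `N`. -/
noncomputable def shiftedSeriesTerm (q z c : ℂ) (N n : ℕ) : ℂ :=
  qPoch q (-(z * q / c)) n * (c * q ^ (N + 1)) ^ n * (qPoch q (z * q) (N + n + 1))⁻¹

lemma exists_norm_shiftedSeriesTerm_le {q z c : ℂ} (hq : ‖q‖ < 1)
    (hz : ∀ n : ℕ, 1 - z * q * q ^ n ≠ 0) :
    ∃ M, 0 ≤ M ∧ ∀ N n, ‖shiftedSeriesTerm q z c N n‖ ≤ M * ‖c * q‖ ^ n := by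
  obtain ⟨M₁, h₁, hM₁⟩ := exists_norm_qPoch_le hq (-(z * q / c))
  obtain ⟨M₂, h₂, hM₂⟩ := exists_norm_inv_qPoch_le hq hz
  refine ⟨M₁ * M₂, by positivity, fun N n => ?_⟩
  have hu : ‖c * q ^ (N + 1)‖ ≤ ‖c * q‖ := by
    rw [pow_succ', ← mul_assoc, norm_mul, norm_pow]
    exact mul_le_of_le_one_right (norm_nonneg _) (pow_le_one₀ (norm_nonneg _) hq.le)
  calc ‖shiftedSeriesTerm q z c N n‖ = ‖qPoch q (-(z * q / c)) n‖ * ‖c * q ^ (N + 1)‖ ^ n *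
        ‖(qPoch q (z * q) (N + n + 1))⁻¹‖ := by
        rw [shiftedSeriesTerm, norm_mul, norm_mul, norm_pow]
    _ ≤ M₁ * ‖c * q‖ ^ n * M₂ := by
        gcongr
        · exact hM₁ n
        · exact hM₂ _
    _ = _ := by ring

lemma summable_shiftedSeriesTerm {q z c : ℂ} (hq : ‖q‖ < 1) (hcq : ‖c * q‖ < 1)
    (hz : ∀ n : ℕ, 1 - z * q * q ^ n ≠ 0) (N : ℕ) : Summable (shiftedSeriesTerm q z c N) := by
  obtain ⟨M, -, hM⟩ := exists_norm_shiftedSeriesTerm_le (c := c) hq hz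
  exact .of_norm_bounded ((summable_geometric_of_lt_one (norm_nonneg _) hcq).mul_left M) (hM N)

lemma exists_norm_tsum_shiftedSeriesTerm_le {q z c : ℂ} (hq : ‖q‖ < 1) (hcq : ‖c * q‖ < 1)
    (hz : ∀ n : ℕ, 1 - z * q * q ^ n ≠ 0) :
    ∃ M, ∀ N, ‖∑' n, shiftedSeriesTerm q z c N n‖ ≤ M := by
  obtain ⟨M, -, hM⟩ := exists_norm_shiftedSeriesTerm_le (c := c) hq hz
  exact ⟨_, fun N => tsum_of_norm_bounded
    ((summable_geometric_of_lt_one (norm_nonneg _) hcq).mul_left M).hasSum (hM N)⟩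

lemma tsum_shiftedSeriesTerm_recurrence {q z c : ℂ} (hq : ‖q‖ < 1) (hcq : ‖c * q‖ < 1)
    (hc : c ≠ 0) (hz : ∀ n : ℕ, 1 - z * q * q ^ n ≠ 0) (N : ℕ) :
    (1 - c * q ^ (N + 1)) * ∑' n, shiftedSeriesTerm q z c N n =
      (qPoch q (z * q) (N + 1))⁻¹ +
        z * q ^ (N + 2) * (1 + c * q ^ (N + 1)) * ∑' n, shiftedSeriesTerm q z c (N + 1) n := by
  have hs := summable_shiftedSeriesTerm hq hcq hz N
  have hs' := (summable_nat_add_iff 1).mpr hs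
  have hterm : ∀ n, shiftedSeriesTerm q z c N (n + 1) -
      c * q ^ (N + 1) * shiftedSeriesTerm q z c N n =
      z * q ^ (N + 2) * (1 + c * q ^ (N + 1)) * shiftedSeriesTerm q z c (N + 1) n := by
    intro n
    have h1 := qPoch_ne_zero hz (N + n + 1)
    have h2 := hz (N + n + 1)
    simp only [shiftedSeriesTerm]
    rw [show N + (n + 1) + 1 = (N + n + 1) + 1 by ring,
      show N + 1 + n + 1 = (N + n + 1) + 1 by ring, qPoch_succ q (z * q) (N + n + 1),
      qPoch_succ q _ n]
    field_simp
    ring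
  have h0 : shiftedSeriesTerm q z c N 0 = (qPoch q (z * q) (N + 1))⁻¹ := by
    simp [shiftedSeriesTerm, qPoch]
  rw [← tsum_mul_left (a := z * q ^ (N + 2) * (1 + c * q ^ (N + 1))), ← tsum_congr hterm,
    hs'.tsum_sub (hs.mul_left _), tsum_mul_left, ← h0, sub_mul, one_mul]
  nth_rewrite 1 [hs.tsum_eq_zero_add]
  ring

/-- Coefficient of the remainder after `N` steps of the recurrence. -/
noncomputable def remainderCoeff (q z c : ℂ) (N : ℕ) : ℂ :=
  z ^ N * q ^ ((N + 1) * (N + 2) / 2) * (qPoch q (-(c * q)) N * (qPoch q (c * q) N)⁻¹)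

lemma summable_norm_remainderCoeff {q z c : ℂ} (hq : ‖q‖ < 1)
    (hc : ∀ n : ℕ, 1 - c * q * q ^ n ≠ 0) : Summable fun N => ‖remainderCoeff q z c N‖ := by
  obtain ⟨M₁, h₁, hM₁⟩ := exists_norm_qPoch_le hq (-(c * q))
  obtain ⟨M₂, h₂, hM₂⟩ := exists_norm_inv_qPoch_le hq hc
  refine .of_nonneg_of_le (fun _ => norm_nonneg _) (fun N => ?_)
    ((summable_norm_pow_mul_pow_triangular hq z).mul_right (M₁ * M₂))
  rw [remainderCoeff, norm_mul, norm_mul (qPoch _ _ _)]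
  gcongr
  · exact hM₁ N
  · exact hM₂ N

lemma summable_qPoch_triangular_term {q z c : ℂ} (hq : ‖q‖ < 1)
    (hz : ∀ n : ℕ, 1 - z * q * q ^ n ≠ 0) (hc : ∀ n : ℕ, 1 - c * q * q ^ n ≠ 0) :
    Summable fun n : ℕ => (z ^ n * qPoch q (-(c * q)) n * q ^ ((n + 1) * (n + 2) / 2)) /
        (qPoch q (z * q) (n + 1) * qPoch q (c * q) (n + 1)) := by
  obtain ⟨M₁, h₁, hM₁⟩ := exists_norm_qPoch_le hq (-(c * q))
  obtain ⟨M₂, h₂, hM₂⟩ := exists_norm_inv_qPoch_le hq hc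
  obtain ⟨M₃, h₃, hM₃⟩ := exists_norm_inv_qPoch_le hq hz
  refine .of_norm_bounded
    ((summable_norm_pow_mul_pow_triangular hq z).mul_right (M₁ * (M₃ * M₂))) fun n => ?_
  rw [div_eq_mul_inv, mul_inv, mul_right_comm (z ^ n), mul_assoc, norm_mul, norm_mul (qPoch _ _ _),
    norm_mul (qPoch _ _ _)⁻¹]
  gcongr
  · exact hM₁ n
  · exact hM₃ _
  · exact hM₂ _

theorem stmt17 (q z c : ℂ) (hq : ‖q‖ < 1) (hcq : ‖c * q‖ < 1) (hc : c ≠ 0)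
    (hz : ∀ n : ℕ, 1 - z * q ^ (n + 1) ≠ 0) (hcn : ∀ n : ℕ, 1 - c * q ^ (n + 1) ≠ 0) :
    ∑' n : ℕ, (z ^ n * qPoch q (-(c * q)) n * q ^ ((n + 1) * (n + 2) / 2)) /
        (qPoch q (z * q) (n + 1) * qPoch q (c * q) (n + 1))
      = ∑' n : ℕ, (qPoch q (-(z * q / c)) n * c ^ n * q ^ (n + 1)) /
          qPoch q (z * q) (n + 1) := by
  have hz' : ∀ n : ℕ, 1 - z * q * q ^ n ≠ 0 := fun n => by
    simpa only [pow_succ', mul_assoc] using hz n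
  have hc' : ∀ n : ℕ, 1 - c * q * q ^ n ≠ 0 := fun n => by
    simpa only [pow_succ', mul_assoc] using hcn n
  set f : ℕ → ℂ := fun n => (z ^ n * qPoch q (-(c * q)) n * q ^ ((n + 1) * (n + 2) / 2)) /
    (qPoch q (z * q) (n + 1) * qPoch q (c * q) (n + 1)) with hf
  set T : ℕ → ℂ := fun N => ∑' n, shiftedSeriesTerm q z c N n with hT
  have hR : ∑' n : ℕ, (qPoch q (-(z * q / c)) n * c ^ n * q ^ (n + 1)) /
      qPoch q (z * q) (n + 1) = q * T 0 := by
    rw [hT, ← tsum_mul_left]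
    refine tsum_congr fun n => ?_
    rw [shiftedSeriesTerm, zero_add, zero_add, pow_one, mul_pow, div_eq_mul_inv]
    ring
  have hstep : ∀ N, remainderCoeff q z c N * T N =
      f N + remainderCoeff q z c (N + 1) * T (N + 1) := by
    intro N
    have hrec : (1 - c * q ^ (N + 1)) * T N = _ :=
      tsum_shiftedSeriesTerm_recurrence hq hcq hc hz' N
    have h1 := hc' N
    have h2 := qPoch_ne_zero hc' N
    have h3 := qPoch_ne_zero hz' (N + 1)
    have hTN : T N = ((qPoch q (z * q) (N + 1))⁻¹ +
        z * q ^ (N + 2) * (1 + c * q ^ (N + 1)) * T (N + 1)) / (1 - c * q * q ^ N) := by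
      rw [eq_div_iff h1, ← hrec]
      ring
    rw [hTN]
    simp only [hf, remainderCoeff]
    rw [triangular_succ, qPoch_succ q (c * q), qPoch_succ q (-(c * q)), pow_add q _ (N + 2)]
    field_simp
    ring
  have hpartial : ∀ N, ∑ n ∈ range N, f n = q * T 0 - remainderCoeff q z c N * T N := by
    intro N
    induction N with
    | zero => simp [remainderCoeff, qPoch]
    | succ N ih => rw [sum_range_succ, ih, hstep N]; ring
  have hlim : Tendsto (fun N => remainderCoeff q z c N * T N) atTop (𝓝 0) := by
    obtain ⟨M, hM⟩ := exists_norm_tsum_shiftedSeriesTerm_le hq hcq hz'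
    refine squeeze_zero_norm (fun N => ?_)
      (by simpa using (summable_norm_remainderCoeff (z := z) hq hc').tendsto_atTop_zero.mul_const M)
    rw [norm_mul]
    gcongr
    exact hM N
  rw [hR]
  refine tendsto_nhds_unique (summable_qPoch_triangular_term hq hz' hc').hasSum.tendsto_sum_nat ?_
  have h := (tendsto_const_nhds (x := q * T 0)).sub hlim
  rw [sub_zero] at h
  exact h.congr fun N => (hpartial N).symm
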